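/- arXiv:2602.23813 — 2 statements merged into one kernel-verified Lean document; each statement's English description precedes it below -/
import Mathlib

section
/- Let k be a field of characteristic ≠ 2 and let i ≥ 1. In the polynomial ring k[x_{jl}] of a (2i+1)×(2i+1) matrix X of indeterminates, consider the ideal I generated by the entries of X^t H X, X H X^t (H the antidiagonal unit matrix) and all (i+1)×(i+1) minors of X. Then the localization of k[X]/I at the determinant of the upper-left i×i block A of X is isomorphic to the localization at det(A) of a polynomial ring in i(2i+1) variables; in particular this localization is a regular (smooth over k) ring. -/
/-- The antidiagonal unit matrix `H_m`. -/
def Hmat (R : Type*) [CommRing R] (m : ℕ) : Matrix (Fin m) (Fin m) R :=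
  Matrix.of fun a b => if (a : ℕ) + (b : ℕ) + 1 = m then 1 else 0

/-- The generic `(2i+1)×(2i+1)` matrix of indeterminates over `k`. -/
noncomputable def genX (k : Type*) [Field k] (i : ℕ) :
    Matrix (Fin (2 * i + 1)) (Fin (2 * i + 1))
      (MvPolynomial (Fin (2 * i + 1) × Fin (2 * i + 1)) k) :=
  Matrix.of fun a b => MvPolynomial.X (a, b)

/-- The ideal generated by the entries of `Xᵀ H X` and `X H Xᵀ` together with all
`(i+1)×(i+1)` minors of the generic matrix `X`. -/
noncomputable def isotropicIdeal (k : Type*) [Field k] (i : ℕ) :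
    Ideal (MvPolynomial (Fin (2 * i + 1) × Fin (2 * i + 1)) k) :=
  Ideal.span
    ({p | ∃ a b, p = ((genX k i).transpose * Hmat _ (2 * i + 1) * genX k i :
        Matrix (Fin (2 * i + 1)) (Fin (2 * i + 1)) _) a b} ∪
     {p | ∃ a b, p = (genX k i * Hmat _ (2 * i + 1) * (genX k i).transpose :
        Matrix (Fin (2 * i + 1)) (Fin (2 * i + 1)) _) a b} ∪
     {p | ∃ f g : Fin (i + 1) → Fin (2 * i + 1),
        Function.Injective f ∧ Function.Injective g ∧ p = ((genX k i).submatrix f g).det})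

/-- The determinant of the upper-left `i×i` block of the generic matrix, as an element
of the quotient ring `R_{i,k} = k[X]/I`. -/
noncomputable def detAbar (k : Type*) [Field k] (i : ℕ) :
    MvPolynomial (Fin (2 * i + 1) × Fin (2 * i + 1)) k ⧸ isotropicIdeal k i :=
  Ideal.Quotient.mk (isotropicIdeal k i)
    (Matrix.det (Matrix.of fun a b : Fin i =>
      genX k i (Fin.castLE (by omega) a) (Fin.castLE (by omega) b)))

/-- The determinant of the `A`-block inside a polynomial ring in `i(2i+1)` variables,
indexed by `Fin i × Fin (2i+1)` (its `A`-block being the first `i` columns). -/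
noncomputable def detAfree (k : Type*) [Field k] (i : ℕ) :
    MvPolynomial (Fin i × Fin (2 * i + 1)) k :=
  Matrix.det (Matrix.of fun a b : Fin i => MvPolynomial.X (a, Fin.castLE (by omega) b))


/-- The `a`-th of the first `i` indices. -/
def loIdx {i : ℕ} (a : Fin i) : Fin (2 * i + 1) := Fin.castLE (by omega) a

/-- The middle index. -/
def midIdx (i : ℕ) : Fin (2 * i + 1) := ⟨i, by omega⟩

/-- The mirror image of `loIdx a` under the order reversal. -/
def hiIdx {i : ℕ} (a : Fin i) : Fin (2 * i + 1) := ⟨2 * i - a, by omega⟩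

/-- Glue functions on the lower, middle and upper (reversed) thirds of the index set. -/
def glue {i : ℕ} {α : Type*} (f : Fin i → α) (m : α) (g : Fin i → α) (c : Fin (2 * i + 1)) : α :=
  if h : (c : ℕ) < i then f ⟨c, h⟩ else
    if h' : (c : ℕ) = i then m else g ⟨2 * i - c, by omega⟩

section glue

variable {i : ℕ} {α : Type*}

@[simp] lemma glue_loIdx (f : Fin i → α) (m : α) (g : Fin i → α) (a : Fin i) :
    glue f m g (loIdx a) = f a := by
  simp [glue, loIdx]

@[simp] lemma glue_midIdx (f : Fin i → α) (m : α) (g : Fin i → α) :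
    glue f m g (midIdx i) = m := by
  simp [glue, midIdx]

@[simp] lemma glue_hiIdx (f : Fin i → α) (m : α) (g : Fin i → α) (a : Fin i) :
    glue f m g (hiIdx a) = g a := by
  have h := a.2
  have h₁ : ¬ (hiIdx a : ℕ) < i := by simp only [hiIdx]; omega
  have h₂ : ¬ (hiIdx a : ℕ) = i := by simp only [hiIdx]; omega
  rw [glue, dif_neg h₁, dif_neg h₂]
  refine congrArg g (Fin.ext ?_)
  change 2 * i - (2 * i - (a : ℕ)) = a
  omega

lemma idx_cases (c : Fin (2 * i + 1)) :
    (∃ a, c = loIdx a) ∨ c = midIdx i ∨ ∃ a, c = hiIdx (i := i) a := by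
  rcases lt_trichotomy (c : ℕ) i with h | h | h
  · exact Or.inl ⟨⟨c, h⟩, rfl⟩
  · exact Or.inr (Or.inl (Fin.ext h))
  · refine Or.inr (Or.inr ⟨⟨2 * i - c, by omega⟩, Fin.ext ?_⟩)
    simp only [hiIdx]
    omega

/-- The decomposition of the index set into its lower, middle and upper parts. -/
def idxEquiv (i : ℕ) : Fin i ⊕ Unit ⊕ Fin i ≃ Fin (2 * i + 1) where
  toFun := Sum.elim loIdx (Sum.elim (fun _ => midIdx i) hiIdx)
  invFun := glue Sum.inl (Sum.inr (Sum.inl ())) (fun a => Sum.inr (Sum.inr a))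
  left_inv := by rintro (a | a | a) <;> simp
  right_inv c := by rcases idx_cases c with ⟨a, rfl⟩ | rfl | ⟨a, rfl⟩ <;> simp

lemma sum_idx {M : Type*} [AddCommMonoid M] (f : Fin (2 * i + 1) → M) :
    ∑ c, f c = ∑ a, f (loIdx a) + (f (midIdx i) + ∑ a, f (hiIdx (i := i) a)) := by
  rw [← (idxEquiv i).sum_comp]
  simp [Fintype.sum_sum_type, idxEquiv]

lemma hiIdx_eq_rev (a : Fin i) : hiIdx a = Fin.rev (loIdx a) := by
  ext; simp [hiIdx, loIdx, Fin.val_rev]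

lemma rev_midIdx : Fin.rev (midIdx i) = midIdx i := by
  ext; simp [midIdx, Fin.val_rev]; omega

end glue

open Matrix

section matrices

variable {S : Type*} [CommRing S] {i : ℕ}

lemma Hmat_mul_apply {m : ℕ} {n : Type*} (M : Matrix (Fin m) n S) (a : Fin m) (b : n) :
    (Hmat S m * M) a b = M (Fin.rev a) b := by
  rw [Matrix.mul_apply, Finset.sum_eq_single (Fin.rev a)]
  · have : (a : ℕ) + (Fin.rev a : ℕ) + 1 = m := by rw [Fin.val_rev]; omega
    rw [Hmat, Matrix.of_apply, if_pos this, one_mul]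
  · intro c _ hc
    have : ¬ (a : ℕ) + (c : ℕ) + 1 = m := by
      intro h
      apply hc
      ext
      rw [Fin.val_rev]
      omega
    simp [Hmat, this]
  · simp

lemma transpose_mul_Hmat_mul_apply {n l : Type*} (N : Matrix (Fin (2 * i + 1)) n S)
    (M : Matrix (Fin (2 * i + 1)) l S) (a : n) (b : l) :
    (Nᵀ * Hmat S (2 * i + 1) * M) a b =
      ∑ c : Fin i, N (loIdx c) a * M (hiIdx c) b + (N (midIdx i) a * M (midIdx i) b +
        ∑ c : Fin i, N (hiIdx c) a * M (loIdx c) b) := by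
  rw [Matrix.mul_assoc, Matrix.mul_apply, sum_idx]
  simp only [Hmat_mul_apply, Matrix.transpose_apply, rev_midIdx, hiIdx_eq_rev, Fin.rev_rev]

lemma Hmat_map {R : Type*} [CommRing R] (φ : R →+* S) (m : ℕ) :
    (Hmat R m).map φ = Hmat S m := by
  ext a b
  simp only [Hmat, Matrix.map_apply, Matrix.of_apply]
  split_ifs <;> simp

/-- The isotropic frame with identity top block, middle row `p`, and reversed lower block whose
strictly upper triangular part is that of `B`; `h` stands for `1/2`. -/
def isoFrame (h : S) (p : Fin i → S) (B : Matrix (Fin i) (Fin i) S) :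
    Matrix (Fin (2 * i + 1)) (Fin i) S :=
  Matrix.of (glue (fun a b => (1 : Matrix (Fin i) (Fin i) S) a b) p fun a b =>
    if a < b then B a b else if a = b then -(h * p a * p a) else -(p a * p b) - B b a)

lemma isoFrame_lo (h : S) (p : Fin i → S) (B : Matrix (Fin i) (Fin i) S) (a b : Fin i) :
    isoFrame h p B (loIdx a) b = (1 : Matrix (Fin i) (Fin i) S) a b := by
  rw [isoFrame, Matrix.of_apply, glue_loIdx]

lemma isoFrame_mid (h : S) (p : Fin i → S) (B : Matrix (Fin i) (Fin i) S) (b : Fin i) :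
    isoFrame h p B (midIdx i) b = p b := by
  rw [isoFrame, Matrix.of_apply, glue_midIdx]

lemma isoFrame_hi (h : S) (p : Fin i → S) (B : Matrix (Fin i) (Fin i) S) (a b : Fin i) :
    isoFrame h p B (hiIdx a) b =
      if a < b then B a b else if a = b then -(h * p a * p a) else -(p a * p b) - B b a := by
  rw [isoFrame, Matrix.of_apply, glue_hiIdx]

lemma isoFrame_isotropic {h : S} (hh : 2 * h = 1) (p : Fin i → S)
    (B : Matrix (Fin i) (Fin i) S) :
    (isoFrame h p B)ᵀ * Hmat S (2 * i + 1) * isoFrame h p B = 0 := by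
  ext a b
  rw [transpose_mul_Hmat_mul_apply]
  simp only [isoFrame_lo, isoFrame_mid, Matrix.one_apply, ite_mul, mul_ite, mul_one, mul_zero,
    one_mul, zero_mul, Finset.sum_ite_eq', Finset.mem_univ, if_true, Matrix.zero_apply]
  simp only [isoFrame_hi]
  rcases lt_trichotomy a b with hab | rfl | hab
  · simp only [hab, hab.not_gt, hab.ne', if_true, if_false]; ring
  · simp only [lt_irrefl, if_true, if_false]
    linear_combination (-(p a * p a)) * hh
  · simp only [hab, hab.not_gt, hab.ne', if_true, if_false]; ring

lemma eq_isoFrame {h : S} (hh : 2 * h = 1) {N : Matrix (Fin (2 * i + 1)) (Fin i) S}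
    (hlo : ∀ a b, N (loIdx a) b = (1 : Matrix (Fin i) (Fin i) S) a b)
    (hN : Nᵀ * Hmat S (2 * i + 1) * N = 0) {p : Fin i → S} {B : Matrix (Fin i) (Fin i) S}
    (hp : ∀ b, N (midIdx i) b = p b) (hB : ∀ a b, a < b → N (hiIdx a) b = B a b) :
    N = isoFrame h p B := by
  have key : ∀ a b, N (hiIdx a) b + (p a * p b + N (hiIdx b) a) = 0 := by
    intro a b
    have := congrFun (congrFun hN a) b
    rw [transpose_mul_Hmat_mul_apply] at this
    simpa [hlo, Matrix.one_apply, hp] using this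
  ext c b
  rcases idx_cases c with ⟨a, rfl⟩ | rfl | ⟨a, rfl⟩
  · rw [hlo, isoFrame_lo]
  · rw [hp, isoFrame_mid]
  · rw [isoFrame_hi]
    split_ifs with h₁ h₂
    · exact hB a b h₁
    · subst h₂
      linear_combination h * key a a - N (hiIdx a) a * hh
    · have h₃ : b < a := lt_of_le_of_ne (not_lt.mp h₁) (Ne.symm h₂)
      rw [← hB b a h₃]
      linear_combination key a b

/-- The first `i` columns, normalized so that the top block is the identity. -/
noncomputable def colFrame (x : Matrix (Fin (2 * i + 1)) (Fin (2 * i + 1)) S) :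
    Matrix (Fin (2 * i + 1)) (Fin i) S :=
  x.submatrix id loIdx * (x.submatrix loIdx loIdx)⁻¹

lemma submatrix_lo_eq_one {N : Matrix (Fin (2 * i + 1)) (Fin i) S}
    (hlo : ∀ a b, N (loIdx a) b = (1 : Matrix (Fin i) (Fin i) S) a b) :
    N.submatrix loIdx id = 1 := by
  ext a b; exact hlo a b

lemma frame_mul_submatrix {N M : Matrix (Fin (2 * i + 1)) (Fin i) S}
    (hM : ∀ a b, M (loIdx a) b = (1 : Matrix (Fin i) (Fin i) S) a b)
    (A : Matrix (Fin i) (Fin i) S) :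
    (N * A * Mᵀ).submatrix id loIdx = N * A := by
  rw [Matrix.submatrix_mul _ _ id id loIdx Function.bijective_id, ← Matrix.transpose_submatrix,
    submatrix_lo_eq_one hM]
  simp

lemma frame_mul_submatrix_lo {N M : Matrix (Fin (2 * i + 1)) (Fin i) S}
    (hN : ∀ a b, N (loIdx a) b = (1 : Matrix (Fin i) (Fin i) S) a b)
    (hM : ∀ a b, M (loIdx a) b = (1 : Matrix (Fin i) (Fin i) S) a b)
    (A : Matrix (Fin i) (Fin i) S) :
    (N * A * Mᵀ).submatrix loIdx loIdx = A := by
  have : (N * A * Mᵀ).submatrix loIdx loIdx =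
      ((N * A * Mᵀ).submatrix id loIdx).submatrix loIdx id := by simp
  rw [this, frame_mul_submatrix hM, Matrix.submatrix_mul _ _ loIdx id id Function.bijective_id,
    submatrix_lo_eq_one hN]
  simp

lemma colFrame_frame_mul {N M : Matrix (Fin (2 * i + 1)) (Fin i) S}
    (hN : ∀ a b, N (loIdx a) b = (1 : Matrix (Fin i) (Fin i) S) a b)
    (hM : ∀ a b, M (loIdx a) b = (1 : Matrix (Fin i) (Fin i) S) a b)
    {A : Matrix (Fin i) (Fin i) S} (hA : IsUnit A.det) :
    colFrame (N * A * Mᵀ) = N := by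
  rw [colFrame, frame_mul_submatrix_lo hN hM, frame_mul_submatrix hM, Matrix.mul_assoc,
    Matrix.mul_nonsing_inv _ hA, Matrix.mul_one]

lemma colFrame_lo {x : Matrix (Fin (2 * i + 1)) (Fin (2 * i + 1)) S}
    (hx : IsUnit (x.submatrix loIdx loIdx).det) (a b : Fin i) :
    colFrame x (loIdx a) b = (1 : Matrix (Fin i) (Fin i) S) a b := by
  rw [← Matrix.mul_nonsing_inv _ hx]
  rfl

lemma colFrame_isotropic {x : Matrix (Fin (2 * i + 1)) (Fin (2 * i + 1)) S}
    (h : xᵀ * Hmat S (2 * i + 1) * x = 0) :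
    (colFrame x)ᵀ * Hmat S (2 * i + 1) * colFrame x = 0 := by
  have h' : (x.submatrix id loIdx)ᵀ * Hmat S (2 * i + 1) * x.submatrix id loIdx = 0 := by
    ext a b
    have := congrFun (congrFun h (loIdx a)) (loIdx b)
    rw [transpose_mul_Hmat_mul_apply] at this ⊢
    exact this
  rw [colFrame, Matrix.transpose_mul]
  simp only [Matrix.mul_assoc] at h' ⊢
  rw [← Matrix.mul_assoc (Hmat S (2 * i + 1)), ← Matrix.mul_assoc (_ᵀ) (_ * _), h']
  simp

lemma det_submatrix_eq_zero {m n : Type*} {l : ℕ} {x : Matrix m n S}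
    (h : ∀ (f : Fin l → m) (g : Fin l → n), Function.Injective f → Function.Injective g →
      (x.submatrix f g).det = 0) (f : Fin l → m) (g : Fin l → n) : (x.submatrix f g).det = 0 := by
  by_cases hf : Function.Injective f
  · by_cases hg : Function.Injective g
    · exact h f g hf hg
    · simp only [Function.Injective, not_forall] at hg
      obtain ⟨a, b, hab, hne⟩ := hg
      exact Matrix.det_zero_of_column_eq hne fun c => by simp [hab]
  · simp only [Function.Injective, not_forall] at hf
    obtain ⟨a, b, hab, hne⟩ := hf
    exact Matrix.det_zero_of_row_eq hne (by ext c; simp [hab])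

lemma eq_colFrame_mul {x : Matrix (Fin (2 * i + 1)) (Fin (2 * i + 1)) S}
    (hx : IsUnit (x.submatrix loIdx loIdx).det)
    (h : ∀ f g : Fin (i + 1) → Fin (2 * i + 1), Function.Injective f → Function.Injective g →
      (x.submatrix f g).det = 0) :
    x = colFrame x * x.submatrix loIdx loIdx * (colFrame xᵀ)ᵀ := by
  set A := x.submatrix loIdx loIdx with hA
  have e₁ : colFrame x * A = x.submatrix id loIdx := by
    rw [colFrame, Matrix.mul_assoc, Matrix.nonsing_inv_mul _ hx, Matrix.mul_one]
  have e₂ : (colFrame xᵀ)ᵀ = A⁻¹ * x.submatrix loIdx id := by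
    rw [colFrame, Matrix.transpose_mul, Matrix.transpose_nonsing_inv]
    rfl
  rw [e₁, e₂]
  ext r c
  let e : Fin i ⊕ Unit ≃ Fin (i + 1) :=
    (Equiv.sumCongr (Equiv.refl _) (Equiv.ofUnique Unit (Fin 1))).trans finSumFinEquiv
  have hdet := det_submatrix_eq_zero h (Sum.elim loIdx (fun _ => r) ∘ e.symm)
    (Sum.elim loIdx (fun _ => c) ∘ e.symm)
  rw [← Matrix.submatrix_submatrix, Matrix.det_submatrix_equiv_self] at hdet
  have hb : x.submatrix (Sum.elim loIdx fun _ : Unit => r) (Sum.elim loIdx fun _ : Unit => c) =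
      Matrix.fromBlocks A (x.submatrix loIdx fun _ => c) (x.submatrix (fun _ => r) loIdx)
        (Matrix.of fun _ _ => x r c) := by
    ext (a | a) (b | b) <;> rfl
  let := Matrix.invertibleOfIsUnitDet A hx
  rw [hb, Matrix.det_fromBlocks₁₁, hx.mul_right_eq_zero, Matrix.det_unique,
    Matrix.invOf_eq_nonsing_inv, Matrix.mul_assoc] at hdet
  exact sub_eq_zero.mp hdet

lemma det_mul_eq_zero_of_lt {m n : ℕ} (hmn : m < n) (N : Matrix (Fin n) (Fin m) S)
    (M : Matrix (Fin m) (Fin n) S) : (N * M).det = 0 := by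
  obtain ⟨d, rfl⟩ := Nat.exists_eq_add_of_lt hmn
  have : N * M = (Matrix.of fun a (b : Fin (m + d + 1)) =>
      if h : (b : ℕ) < m then N a ⟨b, h⟩ else 0) * (Matrix.of fun (b : Fin (m + d + 1)) c =>
      if h : (b : ℕ) < m then M ⟨b, h⟩ c else 0) := by
    ext a c
    rw [Matrix.mul_apply, Matrix.mul_apply]
    change _ = ∑ b : Fin (m + (d + 1)), _
    rw [Fin.sum_univ_add]
    simp
  rw [this, Matrix.det_mul, Matrix.det_eq_zero_of_column_eq_zero (Fin.last _), zero_mul]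
  intro a
  simp

/-- The matrix attached to a point of the affine space of dimension `i(2i+1)`; `h` stands for
`1/2`. -/
def paramMatrix (h : S) (y : Fin i → Fin (2 * i + 1) → S) :
    Matrix (Fin (2 * i + 1)) (Fin (2 * i + 1)) S :=
  isoFrame h (fun a => y a (midIdx i)) (Matrix.of fun a b => y a (hiIdx b)) *
    (Matrix.of fun a b => y a (loIdx b)) *
      (isoFrame h (fun a => y a (hiIdx a)) (Matrix.of fun a b => y b (hiIdx a)))ᵀ

/-- The coordinates of a matrix, inverse to `paramMatrix`. -/
noncomputable def coords (x : Matrix (Fin (2 * i + 1)) (Fin (2 * i + 1)) S) (a : Fin i) :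
    Fin (2 * i + 1) → S :=
  glue (fun b => x (loIdx a) (loIdx b)) (colFrame x (midIdx i) a) fun b =>
    if a = b then colFrame xᵀ (midIdx i) a else
      if a < b then colFrame x (hiIdx a) b else colFrame xᵀ (hiIdx b) a

lemma paramMatrix_submatrix_lo (h : S) (y : Fin i → Fin (2 * i + 1) → S) :
    (paramMatrix h y).submatrix loIdx loIdx = Matrix.of fun a b => y a (loIdx b) :=
  frame_mul_submatrix_lo (isoFrame_lo h _ _) (isoFrame_lo h _ _) _

lemma paramMatrix_transpose_mul {h : S} (hh : 2 * h = 1) (y : Fin i → Fin (2 * i + 1) → S) :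
    (paramMatrix h y)ᵀ * Hmat S (2 * i + 1) * paramMatrix h y = 0 := by
  have := isoFrame_isotropic hh (fun a => y a (midIdx i)) (Matrix.of fun a b => y a (hiIdx b))
  simp only [paramMatrix, Matrix.transpose_mul, Matrix.mul_assoc] at this ⊢
  rw [← Matrix.mul_assoc (Hmat S (2 * i + 1)), ← Matrix.mul_assoc (isoFrame _ _ _)ᵀ (_ * _), this]
  simp

lemma paramMatrix_mul_transpose {h : S} (hh : 2 * h = 1) (y : Fin i → Fin (2 * i + 1) → S) :
    paramMatrix h y * Hmat S (2 * i + 1) * (paramMatrix h y)ᵀ = 0 := by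
  have := isoFrame_isotropic hh (fun a => y a (hiIdx a)) (Matrix.of fun a b => y b (hiIdx a))
  simp only [paramMatrix, Matrix.transpose_mul, Matrix.transpose_transpose,
    Matrix.mul_assoc] at this ⊢
  rw [← Matrix.mul_assoc (Hmat S (2 * i + 1)), ← Matrix.mul_assoc (isoFrame _ _ _)ᵀ (_ * _), this]
  simp

lemma paramMatrix_minor (h : S) (y : Fin i → Fin (2 * i + 1) → S)
    (f g : Fin (i + 1) → Fin (2 * i + 1)) : ((paramMatrix h y).submatrix f g).det = 0 := by
  rw [paramMatrix, Matrix.submatrix_mul _ _ f id g Function.bijective_id]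
  exact det_mul_eq_zero_of_lt (Nat.lt_succ_self i) _ _

lemma coords_paramMatrix (h : S) {y : Fin i → Fin (2 * i + 1) → S}
    (hy : IsUnit (Matrix.of fun a b => y a (loIdx b)).det) :
    coords (paramMatrix h y) = y := by
  have h₁ : colFrame (paramMatrix h y) = _ :=
    colFrame_frame_mul (isoFrame_lo h _ _) (isoFrame_lo h _ _) hy
  have h₂ : colFrame (paramMatrix h y)ᵀ =
      isoFrame h (fun a => y a (hiIdx a)) (Matrix.of fun a b => y b (hiIdx a)) := by
    rw [paramMatrix, Matrix.transpose_mul, Matrix.transpose_mul, Matrix.transpose_transpose,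
      ← Matrix.mul_assoc]
    exact colFrame_frame_mul (isoFrame_lo h _ _) (isoFrame_lo h _ _)
      (by rwa [Matrix.det_transpose])
  ext a c
  rcases idx_cases c with ⟨b, rfl⟩ | rfl | ⟨b, rfl⟩
  · rw [coords, glue_loIdx]
    exact congrFun (congrFun (paramMatrix_submatrix_lo h y) a) b
  · rw [coords, glue_midIdx, h₁, isoFrame_mid]
  · rw [coords, glue_hiIdx, h₁, h₂, isoFrame_mid, isoFrame_hi, isoFrame_hi]
    rcases lt_trichotomy a b with hab | rfl | hab
    · simp [hab, hab.ne]
    · simp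
    · simp [hab, hab.ne', hab.not_gt]

lemma paramMatrix_coords {h : S} (hh : 2 * h = 1)
    {x : Matrix (Fin (2 * i + 1)) (Fin (2 * i + 1)) S}
    (hx : IsUnit (x.submatrix loIdx loIdx).det)
    (h₁ : xᵀ * Hmat S (2 * i + 1) * x = 0) (h₂ : x * Hmat S (2 * i + 1) * xᵀ = 0)
    (h₃ : ∀ f g : Fin (i + 1) → Fin (2 * i + 1), Function.Injective f → Function.Injective g →
      (x.submatrix f g).det = 0) :
    paramMatrix h (coords x) = x := by
  have hx' : IsUnit (xᵀ.submatrix loIdx loIdx).det := by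
    rwa [← Matrix.transpose_submatrix, Matrix.det_transpose]
  conv_rhs => rw [eq_colFrame_mul hx h₃]
  rw [paramMatrix]
  congr 1
  · congr 1
    · refine (eq_isoFrame hh (colFrame_lo hx) (colFrame_isotropic h₁) ?_ ?_).symm
      · intro b; simp [coords]
      · intro a b hab; simp [coords, hab, hab.ne]
    · ext a b; simp [coords]
  · congr 1
    refine (eq_isoFrame hh (colFrame_lo hx') (colFrame_isotropic ?_) ?_ ?_).symm
    · rwa [Matrix.transpose_transpose]
    · intro b; simp [coords]
    · intro a b hab; simp [coords, hab.ne', hab.not_gt]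

section naturality

variable {T : Type*} [CommRing T] (φ : S →+* T)

lemma isoFrame_map (h : S) (p : Fin i → S) (B : Matrix (Fin i) (Fin i) S) :
    (isoFrame h p B).map φ = isoFrame (φ h) (φ ∘ p) (B.map φ) := by
  ext c b
  rcases idx_cases c with ⟨a, rfl⟩ | rfl | ⟨a, rfl⟩
  · rw [Matrix.map_apply, isoFrame_lo, isoFrame_lo, Matrix.one_apply, Matrix.one_apply]
    split_ifs <;> simp
  · simp [isoFrame_mid]
  · rw [Matrix.map_apply, isoFrame_hi, isoFrame_hi]
    split_ifs <;> simp

lemma paramMatrix_map (h : S) (y : Fin i → Fin (2 * i + 1) → S) :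
    (paramMatrix h y).map φ = paramMatrix (φ h) fun a b => φ (y a b) := by
  rw [paramMatrix, Matrix.map_mul, Matrix.map_mul, Matrix.transpose_map, isoFrame_map,
    isoFrame_map]
  rfl

lemma colFrame_map {x : Matrix (Fin (2 * i + 1)) (Fin (2 * i + 1)) S}
    (hx : IsUnit (x.submatrix loIdx loIdx).det) :
    (colFrame x).map φ = colFrame (x.map φ) := by
  have : ((x.submatrix loIdx loIdx)⁻¹).map φ = ((x.map φ).submatrix loIdx loIdx)⁻¹ := by
    refine (Matrix.inv_eq_right_inv ?_).symm
    rw [Matrix.submatrix_map, ← Matrix.map_mul, Matrix.mul_nonsing_inv _ hx]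
    simp
  rw [colFrame, Matrix.map_mul, this]
  rfl

lemma coords_map {x : Matrix (Fin (2 * i + 1)) (Fin (2 * i + 1)) S}
    (hx : IsUnit (x.submatrix loIdx loIdx).det) (a : Fin i) (b : Fin (2 * i + 1)) :
    φ (coords x a b) = coords (x.map φ) a b := by
  have hx' : IsUnit (xᵀ.submatrix loIdx loIdx).det := by
    rwa [← Matrix.transpose_submatrix, Matrix.det_transpose]
  have h₁ : ∀ c d, φ (colFrame x c d) = colFrame (x.map φ) c d := fun c d =>
    congrFun (congrFun (colFrame_map φ hx) c) d
  have h₂ : ∀ c d, φ (colFrame xᵀ c d) = colFrame (x.map φ)ᵀ c d := fun c d =>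
    congrFun (congrFun (colFrame_map φ hx') c) d
  rcases idx_cases b with ⟨b, rfl⟩ | rfl | ⟨b, rfl⟩
  · simp [coords]
  · simp [coords, h₁]
  · simp only [coords, glue_hiIdx, apply_ite φ, h₁, h₂]

end naturality

end matrices

lemma detAbar_eq (k : Type*) [Field k] (i : ℕ) :
    detAbar k i = Ideal.Quotient.mk _ ((genX k i).submatrix loIdx loIdx).det := rfl

section universal

variable {k : Type*} [Field k] {i : ℕ} {S : Type*} [CommRing S]

lemma genX_map_aeval [Algebra k S] (x : Matrix (Fin (2 * i + 1)) (Fin (2 * i + 1)) S) :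
    (genX k i).map (MvPolynomial.aeval (R := k) fun c => x c.1 c.2) = x := by
  ext a b
  simp [genX]

lemma map_det_genX_lo {F : Type*}
    [FunLike F (MvPolynomial (Fin (2 * i + 1) × Fin (2 * i + 1)) k) S]
    [RingHomClass F (MvPolynomial (Fin (2 * i + 1) × Fin (2 * i + 1)) k) S] (φ : F) :
    φ ((genX k i).submatrix loIdx loIdx).det =
      (((genX k i).map φ).submatrix loIdx loIdx).det :=
  RingHom.map_det (φ : MvPolynomial (Fin (2 * i + 1) × Fin (2 * i + 1)) k →+* S) _

lemma isotropicIdeal_le_ker [Algebra k S]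
    {x : Matrix (Fin (2 * i + 1)) (Fin (2 * i + 1)) S}
    (h₁ : xᵀ * Hmat S (2 * i + 1) * x = 0) (h₂ : x * Hmat S (2 * i + 1) * xᵀ = 0)
    (h₃ : ∀ f g : Fin (i + 1) → Fin (2 * i + 1), (x.submatrix f g).det = 0) :
    isotropicIdeal k i ≤ RingHom.ker (MvPolynomial.aeval (R := k) fun c => x c.1 c.2) := by
  set φ : MvPolynomial (Fin (2 * i + 1) × Fin (2 * i + 1)) k →ₐ[k] S :=
    MvPolynomial.aeval fun c => x c.1 c.2 with hφ
  have hX : (genX k i).map (φ : _ →+* S) = x := genX_map_aeval x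
  rw [isotropicIdeal, Ideal.span_le]
  rintro q ((⟨a, b, rfl⟩ | ⟨a, b, rfl⟩) | ⟨f, g, -, -, rfl⟩)
  · change (((genX k i)ᵀ * Hmat _ (2 * i + 1) * genX k i).map (φ : _ →+* S)) a b = 0
    rw [Matrix.map_mul, Matrix.map_mul, Hmat_map, Matrix.transpose_map, hX, h₁, Matrix.zero_apply]
  · change ((genX k i * Hmat _ (2 * i + 1) * (genX k i)ᵀ).map (φ : _ →+* S)) a b = 0
    rw [Matrix.map_mul, Matrix.map_mul, Hmat_map, Matrix.transpose_map, hX, h₂, Matrix.zero_apply]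
  · change (φ : MvPolynomial (Fin (2 * i + 1) × Fin (2 * i + 1)) k →+* S) _ = 0
    rw [RingHom.map_det, RingHom.mapMatrix_apply, ← Matrix.submatrix_map, hX, h₃]

lemma genX_map_transpose_mul
    (φ : MvPolynomial (Fin (2 * i + 1) × Fin (2 * i + 1)) k →+* S)
    (hφ : ∀ p ∈ isotropicIdeal k i, φ p = 0) :
    ((genX k i).map φ)ᵀ * Hmat S (2 * i + 1) * (genX k i).map φ = 0 := by
  rw [← Hmat_map φ, ← Matrix.transpose_map, ← Matrix.map_mul, ← Matrix.map_mul]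
  ext a b
  exact hφ _ (Ideal.subset_span (Or.inl (Or.inl ⟨a, b, rfl⟩)))

lemma genX_map_mul_transpose
    (φ : MvPolynomial (Fin (2 * i + 1) × Fin (2 * i + 1)) k →+* S)
    (hφ : ∀ p ∈ isotropicIdeal k i, φ p = 0) :
    (genX k i).map φ * Hmat S (2 * i + 1) * ((genX k i).map φ)ᵀ = 0 := by
  rw [← Hmat_map φ, ← Matrix.transpose_map, ← Matrix.map_mul, ← Matrix.map_mul]
  ext a b
  exact hφ _ (Ideal.subset_span (Or.inl (Or.inr ⟨a, b, rfl⟩)))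

lemma genX_map_minor
    (φ : MvPolynomial (Fin (2 * i + 1) × Fin (2 * i + 1)) k →+* S)
    (hφ : ∀ p ∈ isotropicIdeal k i, φ p = 0)
    (f g : Fin (i + 1) → Fin (2 * i + 1)) (hf : Function.Injective f)
    (hg : Function.Injective g) : (((genX k i).map φ).submatrix f g).det = 0 := by
  rw [Matrix.submatrix_map, ← RingHom.mapMatrix_apply, ← RingHom.map_det]
  exact hφ _ (Ideal.subset_span (Or.inr ⟨f, g, hf, hg, rfl⟩))

end universal

set_option synthInstance.maxHeartbeats 1000000 in
set_option maxHeartbeats 1000000 in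
/-- Let `k` be a field of characteristic `≠ 2`, `i ≥ 1`.  The localization
of `R_{i,k} = k[X]/(Xᵀ H X, X H Xᵀ, ∧^{i+1} X)` at the determinant of the upper-left
`i×i` block `A` of `X` is isomorphic to the localization at `det A` of a polynomial
ring in `i(2i+1)` variables. -/
theorem localization_detA_iso_polynomial (k : Type*) [Field k] (hk : (2 : k) ≠ 0)
    (i : ℕ) (hi : 1 ≤ i) :
    Nonempty (Localization.Away (detAbar k i) ≃+* Localization.Away (detAfree k i)) := by
  set L := Localization.Away (detAbar k i)
  set M := Localization.Away (detAfree k i)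
  have hh : ∀ (S : Type _) [CommRing S] [Algebra k S], 2 * algebraMap k S 2⁻¹ = 1 := by
    intro S _ _
    rw [← map_ofNat (algebraMap k S) 2, ← map_mul, mul_inv_cancel₀ hk, map_one]
  -- the universal point of the source
  let φ : MvPolynomial (Fin (2 * i + 1) × Fin (2 * i + 1)) k →+* L :=
    (algebraMap _ L).comp (Ideal.Quotient.mk (isotropicIdeal k i))
  have hφ : ∀ p ∈ isotropicIdeal k i, φ p = 0 := fun p hp => by
    simp [φ, Ideal.Quotient.eq_zero_iff_mem.mpr hp]
  let x : Matrix (Fin (2 * i + 1)) (Fin (2 * i + 1)) L := (genX k i).map φ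
  have hx : IsUnit (x.submatrix loIdx loIdx).det := by
    rw [Matrix.submatrix_map, ← RingHom.mapMatrix_apply, ← RingHom.map_det]
    exact IsLocalization.Away.algebraMap_isUnit (detAbar k i)
  have hxc : paramMatrix (algebraMap k L 2⁻¹) (coords x) = x :=
    paramMatrix_coords (hh L) hx (genX_map_transpose_mul φ hφ) (genX_map_mul_transpose φ hφ)
      (genX_map_minor φ hφ)
  -- the universal point of the target
  let y : Fin i → Fin (2 * i + 1) → M := fun a b =>
    algebraMap (MvPolynomial (Fin i × Fin (2 * i + 1)) k) M (MvPolynomial.X (a, b))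
  have hy : IsUnit (Matrix.of fun a b => y a (loIdx b)).det := by
    have : (Matrix.of fun a b => y a (loIdx b)).det = algebraMap _ M (detAfree k i) :=
      (RingHom.map_det (algebraMap _ M) _).symm
    rw [this]
    exact IsLocalization.Away.algebraMap_isUnit (detAfree k i)
  let z := paramMatrix (algebraMap k M 2⁻¹) y
  let g₀ := Ideal.Quotient.liftₐ (isotropicIdeal k i)
    (MvPolynomial.aeval (R := k) fun c => z c.1 c.2)
    (isotropicIdeal_le_ker (paramMatrix_transpose_mul (hh M) y)
      (paramMatrix_mul_transpose (hh M) y) (paramMatrix_minor _ y))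
  have hg₀X : ∀ p, g₀ (Ideal.Quotient.mk _ p) =
      MvPolynomial.aeval (R := k) (fun c => z c.1 c.2) p := fun p => rfl
  have hg₀ : IsUnit (g₀ (detAbar k i)) := by
    have : g₀ (detAbar k i) = (z.submatrix loIdx loIdx).det := by
      rw [detAbar_eq, hg₀X, map_det_genX_lo, genX_map_aeval]
    rwa [this, paramMatrix_submatrix_lo]
  let g : L →ₐ[k] M := IsLocalization.Away.liftAlgHom (detAbar k i) hg₀
  have hg : x.map (g : L →+* M) = z := by
    ext a b
    refine (IsLocalization.Away.lift_eq (detAbar k i) hg₀ _).trans ?_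
    exact congrFun (congrFun (genX_map_aeval (k := k) z) a) b
  let f₀ : MvPolynomial (Fin i × Fin (2 * i + 1)) k →ₐ[k] L :=
    MvPolynomial.aeval fun c => coords x c.1 c.2
  have hf₀ : IsUnit (f₀ (detAfree k i)) := by
    have : f₀ (detAfree k i) = (x.submatrix loIdx loIdx).det := by
      rw [detAfree, AlgHom.map_det]
      congr 1
      ext a b
      refine (MvPolynomial.aeval_X _ _).trans ?_
      exact glue_loIdx _ _ _ b
    rwa [this]
  let f : M →ₐ[k] L := IsLocalization.Away.liftAlgHom (detAfree k i) hf₀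
  have hf : ∀ a b, f (y a b) = coords x a b := fun a b =>
    (IsLocalization.Away.lift_eq (detAfree k i) hf₀ _).trans (MvPolynomial.aeval_X _ _)
  refine ⟨(AlgEquiv.ofAlgHom g f ?_ ?_).toRingEquiv⟩
  · refine IsLocalization.algHom_ext (Submonoid.powers (detAfree k i)) (MvPolynomial.algHom_ext ?_)
    rintro ⟨a, b⟩
    change g (f (y a b)) = y a b
    rw [hf]
    refine (coords_map (g : L →+* M) hx a b).trans ?_
    rw [hg, coords_paramMatrix _ hy]
  · refine IsLocalization.algHom_ext (Submonoid.powers (detAbar k i))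
      (Ideal.Quotient.algHom_ext _ (MvPolynomial.algHom_ext ?_))
    rintro ⟨a, b⟩
    change f ((x.map (g : L →+* M)) a b) = x a b
    rw [hg]
    change ((z.map (f : M →+* L)) a b) = x a b
    rw [paramMatrix_map]
    have hfy : (fun a b => (f : M →+* L) (y a b)) = coords x := by
      ext a b
      exact hf a b
    rw [hfy, AlgHom.coe_toRingHom, AlgHom.commutes, hxc]
end

section
/- Let k be a field of characteristic ≠ 2. The ring k[x, y_{12}, y_{21}, y_{22}]/(x(y_{22} - y_{12}y_{21})) is reduced, and its spectrum has exactly two irreducible components, cut out by x = 0 and by y_{22} = y_{12}y_{21}, each of which is smooth over k; moreover these two components intersect in a smooth subvariety of codimension one in each. -/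
section QuotientPresentation

open MvPolynomial

variable {R σ τ : Type*} [CommRing R]

/-- A quotient of `R[σ]` is the polynomial ring on a subset `τ` of the variables, as soon as the
relations allow every variable to be rewritten as a polynomial `f i` in the variables of `τ`. -/
noncomputable def MvPolynomial.quotientSpanEquiv (S : Set (MvPolynomial σ R))
    (f : σ → MvPolynomial τ R) (g : τ → σ) (hS : ∀ s ∈ S, aeval f s = 0)
    (hfg : ∀ i, f (g i) = X i) (hgf : ∀ i, X i - rename g (f i) ∈ Ideal.span S) :
    (MvPolynomial σ R ⧸ Ideal.span S) ≃ₐ[R] MvPolynomial τ R :=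
  AlgEquiv.ofAlgHom
    (Ideal.Quotient.liftₐ (Ideal.span S) (aeval f) fun _ ha ↦
      (Ideal.span_le (I := RingHom.ker (aeval (R := R) f))).2 hS ha)
    ((Ideal.Quotient.mkₐ R (Ideal.span S)).comp (rename g))
    (MvPolynomial.algHom_ext fun i ↦ by
      change aeval f (rename g (X i)) = X i
      simp [hfg])
    (by
      refine Ideal.Quotient.algHom_ext R (MvPolynomial.algHom_ext fun i ↦ ?_)
      change Ideal.Quotient.mk _ (rename g (aeval f (X i))) = Ideal.Quotient.mk _ (X i)
      rw [aeval_X]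
      exact ((Ideal.Quotient.mk_eq_mk_iff_sub_mem _ _).2 (hgf i)).symm)

instance MvPolynomial.algebraSmooth [Finite σ] : Algebra.Smooth R (MvPolynomial σ R) where

end QuotientPresentation

theorem irreducibleComponents_eq_pair {T : Type*} [TopologicalSpace T] {A B : Set T}
    (hA : IsIrreducible A) (hB : IsIrreducible B) (hAc : IsClosed A) (hBc : IsClosed B)
    (hAB : A ∪ B = Set.univ) (hnAB : ¬ A ⊆ B) (hnBA : ¬ B ⊆ A) :
    irreducibleComponents T = {A, B} := by
  have key (s : Set T) (hs : IsIrreducible s) : s ⊆ A ∨ s ⊆ B :=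
    isPreirreducible_iff_isClosed_union_isClosed.1 hs.2 A B hAc hBc (hAB ▸ Set.subset_univ s)
  ext s
  constructor
  · rintro ⟨hs, hmax⟩
    rcases key s hs with h | h
    · exact .inl (h.antisymm (hmax hA h))
    · exact .inr (h.antisymm (hmax hB h))
  · rintro (rfl | rfl)
    · refine ⟨hA, fun t ht hst ↦ (key t ht).resolve_right fun h ↦ hnAB (hst.trans h)⟩
    · refine ⟨hB, fun t ht hst ↦ (key t ht).resolve_left fun h ↦ hnBA (hst.trans h)⟩

section ProductOfTwoPrimes

open PrimeSpectrum

variable {R : Type*} [CommRing R] {p q : R}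

theorem isReduced_quotient_span_mul_of_prime (hp : Prime p) (hq : Prime q) (hqp : ¬ q ∣ p) :
    IsReduced (R ⧸ Ideal.span {p * q}) := by
  rw [← Ideal.isRadical_iff_quotient_reduced, ← isRadical_iff_span_singleton]
  intro n a h
  obtain ⟨b, rfl⟩ := hp.dvd_of_dvd_pow ((dvd_mul_right p q).trans h)
  exact mul_dvd_mul_left p
    ((hq.dvd_or_dvd (hq.dvd_of_dvd_pow ((dvd_mul_left q p).trans h))).resolve_left hqp)

theorem Ideal.isPrime_span_mk_of_prime {I : Ideal R} (hp : Prime p) (hI : I ≤ Ideal.span {p}) :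
    (Ideal.span {Ideal.Quotient.mk I p}).IsPrime := by
  have := (Ideal.span_singleton_prime hp.ne_zero).2 hp
  have := Ideal.map_isPrime_of_surjective (f := Ideal.Quotient.mk I) Ideal.Quotient.mk_surjective
    (I := Ideal.span {p}) (by simpa using hI)
  rwa [Ideal.map_span, Set.image_singleton] at this

theorem PrimeSpectrum.not_zeroLocus_mk_subset {I : Ideal R} (hp : Prime p)
    (hI : I ≤ Ideal.span {p}) (hpq : ¬ p ∣ q) :
    ¬ zeroLocus {Ideal.Quotient.mk I p} ⊆ zeroLocus {Ideal.Quotient.mk I q} := by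
  have hP := Ideal.isPrime_span_mk_of_prime hp hI
  intro h
  have hmem : Ideal.Quotient.mk I q ∈ Ideal.span {Ideal.Quotient.mk I p} := by
    simpa using @h ⟨_, hP⟩ (by simp)
  rw [← Set.image_singleton, ← Ideal.map_span,
    Ideal.mem_quotient_iff_mem hI, Ideal.mem_span_singleton] at hmem
  exact hpq hmem

theorem PrimeSpectrum.isIrreducible_zeroLocus_mk {I : Ideal R} (hp : Prime p)
    (hI : I ≤ Ideal.span {p}) : IsIrreducible (zeroLocus {Ideal.Quotient.mk I p}) := by
  have hP := Ideal.isPrime_span_mk_of_prime hp hI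
  rw [← zeroLocus_span]
  exact (isIrreducible_zeroLocus_iff_of_radical _ hP.isRadical).2 hP

theorem PrimeSpectrum.irreducibleComponents_quotient_span_mul (hp : Prime p) (hq : Prime q)
    (hpq : ¬ p ∣ q) (hqp : ¬ q ∣ p) :
    irreducibleComponents (PrimeSpectrum (R ⧸ Ideal.span {p * q})) =
      {zeroLocus {Ideal.Quotient.mk (Ideal.span {p * q}) p},
        zeroLocus {Ideal.Quotient.mk (Ideal.span {p * q}) q}} := by
  have hIp : Ideal.span {p * q} ≤ Ideal.span {p} :=
    Ideal.span_singleton_le_span_singleton.2 (dvd_mul_right p q)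
  have hIq : Ideal.span {p * q} ≤ Ideal.span {q} :=
    Ideal.span_singleton_le_span_singleton.2 (dvd_mul_left q p)
  refine irreducibleComponents_eq_pair (isIrreducible_zeroLocus_mk hp hIp)
    (isIrreducible_zeroLocus_mk hq hIq) (isClosed_zeroLocus _) (isClosed_zeroLocus _) ?_
    (not_zeroLocus_mk_subset hp hIp hpq) (not_zeroLocus_mk_subset hq hIq hqp)
  rw [← zeroLocus_singleton_mul, ← map_mul,
    Ideal.Quotient.eq_zero_iff_mem.2 (Ideal.mem_span_singleton_self _), zeroLocus_singleton_zero]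

end ProductOfTwoPrimes

section Components

open MvPolynomial

variable (k : Type*) [CommRing k]

/-- The hyperplane `x = 0` is an affine 3-space. -/
noncomputable def hyperplaneEquiv :
    (MvPolynomial (Fin 4) k ⧸ Ideal.span {(X 0 : MvPolynomial (Fin 4) k)}) ≃ₐ[k]
      MvPolynomial (Fin 3) k :=
  quotientSpanEquiv _ ![0, X 0, X 1, X 2] ![1, 2, 3] (by simp)
    (fun i ↦ by fin_cases i <;> rfl)
    (fun i ↦ by fin_cases i <;> simp)

/-- The graph `y₂₂ = y₁₂y₂₁` is an affine 3-space. -/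
noncomputable def graphEquiv :
    (MvPolynomial (Fin 4) k ⧸ Ideal.span {(X 3 - X 1 * X 2 : MvPolynomial (Fin 4) k)}) ≃ₐ[k]
      MvPolynomial (Fin 3) k :=
  quotientSpanEquiv _ ![X 0, X 1, X 2, X 1 * X 2] ![0, 1, 2] (by simp)
    (fun i ↦ by fin_cases i <;> rfl)
    (fun i ↦ by
      fin_cases i <;> simp)

/-- The intersection of `x = 0` with the graph `y₂₂ = y₁₂y₂₁` is an affine plane. -/
noncomputable def intersectionEquiv :
    (MvPolynomial (Fin 4) k ⧸
      Ideal.span {(X 0 : MvPolynomial (Fin 4) k), X 3 - X 1 * X 2}) ≃ₐ[k]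
      MvPolynomial (Fin 2) k :=
  quotientSpanEquiv _ ![0, X 0, X 1, X 0 * X 1] ![1, 2] (by simp)
    (fun i ↦ by fin_cases i <;> rfl)
    (fun i ↦ by
      fin_cases i <;> simp
      all_goals exact Ideal.subset_span (by simp))

end Components

theorem prime_of_quotient_span_equiv {A B : Type*} [CommRing A] [CommRing B] [IsDomain B] {p : A}
    (e : (A ⧸ Ideal.span {p}) ≃+* B) (hp : p ≠ 0) : Prime p := by
  have := e.toMulEquiv.isDomain
  exact (Ideal.span_singleton_prime hp).1 ((Ideal.Quotient.isDomain_iff_prime _).1 this)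

open MvPolynomial PrimeSpectrum in
/-- Let `k` be a field of characteristic `≠ 2`.  The ring
`Q = k[x, y₁₂, y₂₁, y₂₂]/(x(y₂₂ - y₁₂y₂₁))` (variables `X 0 = x`, `X 1 = y₁₂`,
`X 2 = y₂₁`, `X 3 = y₂₂`) is reduced, and `Spec Q` has exactly two irreducible
components, cut out by `x = 0` and by `y₂₂ = y₁₂y₂₁`; each component (i.e. the quotient
of the polynomial ring by the corresponding equation) is smooth over `k`, and the two
components intersect in a subvariety that is smooth over `k` and of codimension one in
each component (Krull dimension one less). -/
theorem reduced_two_smooth_components (k : Type*) [Field k] (hk : (2 : k) ≠ 0) :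
    IsReduced
        (MvPolynomial (Fin 4) k ⧸
          Ideal.span {(X 0 : MvPolynomial (Fin 4) k) * (X 3 - X 1 * X 2)}) ∧
      irreducibleComponents
          (PrimeSpectrum
            (MvPolynomial (Fin 4) k ⧸
              Ideal.span {(X 0 : MvPolynomial (Fin 4) k) * (X 3 - X 1 * X 2)})) =
        {zeroLocus
            {Ideal.Quotient.mk
              (Ideal.span {(X 0 : MvPolynomial (Fin 4) k) * (X 3 - X 1 * X 2)}) (X 0)},
         zeroLocus
            {Ideal.Quotient.mk
              (Ideal.span {(X 0 : MvPolynomial (Fin 4) k) * (X 3 - X 1 * X 2)})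
              (X 3 - X 1 * X 2)}} ∧
      zeroLocus
          {Ideal.Quotient.mk
            (Ideal.span {(X 0 : MvPolynomial (Fin 4) k) * (X 3 - X 1 * X 2)}) (X 0)} ≠
        zeroLocus
          {Ideal.Quotient.mk
            (Ideal.span {(X 0 : MvPolynomial (Fin 4) k) * (X 3 - X 1 * X 2)})
            (X 3 - X 1 * X 2)} ∧
      Algebra.Smooth k
        (MvPolynomial (Fin 4) k ⧸ Ideal.span {(X 0 : MvPolynomial (Fin 4) k)}) ∧
      Algebra.Smooth k
        (MvPolynomial (Fin 4) k ⧸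
          Ideal.span {(X 3 - X 1 * X 2 : MvPolynomial (Fin 4) k)}) ∧
      Algebra.Smooth k
        (MvPolynomial (Fin 4) k ⧸
          Ideal.span {(X 0 : MvPolynomial (Fin 4) k), X 3 - X 1 * X 2}) ∧
      ringKrullDim
            (MvPolynomial (Fin 4) k ⧸
              Ideal.span {(X 0 : MvPolynomial (Fin 4) k), X 3 - X 1 * X 2}) + 1 =
        ringKrullDim
          (MvPolynomial (Fin 4) k ⧸ Ideal.span {(X 0 : MvPolynomial (Fin 4) k)}) := by
  have hpq : ¬ (X 0 : MvPolynomial (Fin 4) k) ∣ X 3 - X 1 * X 2 := fun h ↦ by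
    simpa using map_dvd (eval ![(0 : k), 0, 0, 1]) h
  have hqp : ¬ (X 3 - X 1 * X 2 : MvPolynomial (Fin 4) k) ∣ X 0 := fun h ↦ by
    simpa using map_dvd (eval ![(1 : k), 0, 0, 0]) h
  have hp : Prime (X 0 : MvPolynomial (Fin 4) k) :=
    prime_of_quotient_span_equiv (hyperplaneEquiv k).toRingEquiv fun h ↦ hqp (h ▸ dvd_zero _)
  have hq : Prime (X 3 - X 1 * X 2 : MvPolynomial (Fin 4) k) :=
    prime_of_quotient_span_equiv (graphEquiv k).toRingEquiv fun h ↦ hpq (h ▸ dvd_zero _)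
  refine ⟨isReduced_quotient_span_mul_of_prime hp hq hqp,
    irreducibleComponents_quotient_span_mul hp hq hpq hqp,
    fun h ↦ not_zeroLocus_mk_subset hp
      (Ideal.span_singleton_le_span_singleton.2 (dvd_mul_right _ _)) hpq h.subset,
    .of_equiv (hyperplaneEquiv k).symm, .of_equiv (graphEquiv k).symm,
    .of_equiv (intersectionEquiv k).symm, ?_⟩
  rw [ringKrullDim_eq_of_ringEquiv (hyperplaneEquiv k).toRingEquiv,
    ringKrullDim_eq_of_ringEquiv (intersectionEquiv k).toRingEquiv,
    ringKrullDim_of_isNoetherianRing, ringKrullDim_of_isNoetherianRing,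
    ringKrullDim_eq_zero_of_field]
  norm_num
end
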